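/- Johnson–Lindenstrauss lemma (Gaussian version): let N > 16 points u : Fin N → (Fin d → ℝ) be given, let ε ∈ (0, 1/2), and let k be a positive integer with (k : ℝ) ≥ 9·log N/(ε² − ε³). Then with probability at least 1/2 over the random Gaussian matrix P, all pairwise squared distances are preserved to within a factor 1 ± ε: μ{P : ∀ i i' : Fin N, (1 − ε)·‖u i − u i'‖² ≤ ‖Matrix.vecMul (u i) P − Matrix.vecMul (u i') P‖² ≤ (1 + ε)·‖u i − u i'‖²} ≥ 1/2. -/

import Mathlib

open MeasureTheory ProbabilityTheory Matrix
open scoped NNReal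

/-- Euclidean norm of a vector. -/
noncomputable def vecNorm {m : ℕ} (v : Fin m → ℝ) : ℝ :=
  Real.sqrt (∑ i, (v i) ^ 2)

/-- Transposing a random matrix with i.i.d. entries preserves its law. -/
lemma measurePreserving_pi_transpose {ι κ X : Type*} [Fintype ι] [Fintype κ]
    [MeasurableSpace X] (ν : Measure X) [IsProbabilityMeasure ν] :
    MeasurePreserving (fun (P : ι → κ → X) j i => P i j)
      (Measure.pi fun _ => Measure.pi fun _ => ν) (Measure.pi fun _ => Measure.pi fun _ => ν) := by
  have hι := Measure.infinitePi_map_curry (fun (_ : ι) (_ : κ) => ν)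
  have hκ := Measure.infinitePi_map_curry (fun (_ : κ) (_ : ι) => ν)
  have hswap := (measurePreserving_piCongrLeft (fun _ : κ × ι => ν) (Equiv.prodComm ι κ)).map_eq
  simp only [Measure.infinitePi_eq_pi] at hι hκ
  refine ⟨by fun_prop, ?_⟩
  rw [← hι, ← hκ, ← hswap, Measure.map_map (by fun_prop) (by fun_prop),
    Measure.map_map (by fun_prop) (by fun_prop)]
  congr 1

/-- A linear combination of i.i.d. centered Gaussians is a centered Gaussian. -/
lemma map_pi_gaussianReal_sum_mul {ι : Type*} [Fintype ι] (w : ι → ℝ) (v : ℝ≥0) :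
    (Measure.pi fun _ : ι => gaussianReal 0 v).map (fun r => ∑ i, w i * r i) =
      gaussianReal 0 (Real.toNNReal (∑ i, w i ^ 2) * v) := by
  have hmap : ∀ i, (Measure.pi fun _ : ι => gaussianReal 0 v).map (fun r => w i * r i) =
      gaussianReal 0 (.mk (w i ^ 2) (sq_nonneg _) * v) := by
    intro i
    have := (measurePreserving_eval (fun _ : ι => gaussianReal 0 v) i).map_eq
    have h2 := gaussianReal_map_const_mul (μ := 0) (v := v) (w i)
    rw [← this, Measure.map_map (by fun_prop) (by fun_prop), mul_zero] at h2
    exact h2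
  have hind : iIndepFun (fun i (r : ι → ℝ) => w i * r i)
      (Measure.pi fun _ : ι => gaussianReal 0 v) :=
    iIndepFun_pi (X := fun i x => w i * x) (fun i => by fun_prop)
  apply Measure.ext_of_charFun
  rw [hind.charFun_map_fun_sum_eq_prod
    (fun i => Measurable.aemeasurable (by fun_prop))]
  ext t
  simp only [Finset.prod_apply, hmap, charFun_gaussianReal, ← Complex.exp_sum]
  congr 1
  have hnn : 0 ≤ ∑ i, w i ^ 2 := Finset.sum_nonneg fun i _ => sq_nonneg _
  simp only [NNReal.coe_mul, Real.coe_toNNReal _ hnn, NNReal.coe_mk]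
  push_cast
  simp [Finset.sum_mul, Finset.sum_div]

/-- The moment generating function of the square of a centered Gaussian. -/
lemma integral_exp_mul_sq_gaussianReal {v : ℝ≥0} (hv : v ≠ 0) {s : ℝ} (hs : 2 * s * v < 1) :
    ∫ x, Real.exp (s * x ^ 2) ∂gaussianReal 0 v = (√(1 - 2 * s * v))⁻¹ := by
  have hv' : (0 : ℝ) < v := by positivity
  have hpos : 0 < 1 - 2 * s * v := by linarith
  rw [integral_gaussianReal_eq_integral_smul hv]
  have : ∀ x : ℝ, gaussianPDFReal 0 v x • Real.exp (s * x ^ 2) =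
      (√(2 * Real.pi * v))⁻¹ * Real.exp (-((1 - 2 * s * v) / (2 * v)) * x ^ 2) := by
    intro x
    rw [gaussianPDFReal, smul_eq_mul, mul_assoc, ← Real.exp_add]
    congr 2
    field_simp
    ring
  simp_rw [this]
  rw [integral_const_mul, integral_gaussian, ← Real.sqrt_inv, ← Real.sqrt_inv,
    ← Real.sqrt_mul (by positivity)]
  congr 1
  have := Real.pi_pos
  field_simp

lemma integrable_exp_mul_sq_gaussianReal {v : ℝ≥0} (hv : v ≠ 0) {s : ℝ} (hs : 2 * s * v < 1) :
    Integrable (fun x => Real.exp (s * x ^ 2)) (gaussianReal 0 v) := by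
  by_contra h
  have h1 := integral_exp_mul_sq_gaussianReal hv hs
  rw [integral_undef h] at h1
  have : 0 < (√(1 - 2 * s * v))⁻¹ := inv_pos.2 (Real.sqrt_pos.2 (by linarith))
  linarith

/-- The squared norm of the projection of `w`, as a function of the transposed matrix. -/
noncomputable def projSq {d k : ℕ} (w : Fin d → ℝ) (Q : Fin k → Fin d → ℝ) : ℝ :=
  ∑ j, (∑ i, w i * Q j i) ^ 2

lemma mgf_projSq {d k : ℕ} {v : ℝ≥0} (hv : v ≠ 0) (w : Fin d → ℝ) (hw : 0 < ∑ i, w i ^ 2) {s : ℝ}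
    (hs : 2 * s * ((∑ i, w i ^ 2) * v) < 1) :
    Integrable (fun Q => Real.exp (s * projSq w Q))
        (Measure.pi fun _ : Fin k => Measure.pi fun _ : Fin d => gaussianReal 0 v) ∧
      mgf (projSq w) (Measure.pi fun _ : Fin k => Measure.pi fun _ : Fin d => gaussianReal 0 v) s =
        ((√(1 - 2 * s * ((∑ i, w i ^ 2) * v)))⁻¹) ^ k := by
  have hexp : ∀ Q : Fin k → Fin d → ℝ, Real.exp (s * projSq w Q) =
      ∏ j, Real.exp (s * (∑ i, w i * Q j i) ^ 2) := by
    intro Q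
    rw [projSq, Finset.mul_sum, Real.exp_sum]
  have hv' : Real.toNNReal (∑ i, w i ^ 2) * v ≠ 0 :=
    mul_ne_zero (Real.toNNReal_pos.2 hw).ne' hv
  have hs' : 2 * s * ((Real.toNNReal (∑ i, w i ^ 2) * v : ℝ≥0) : ℝ) < 1 := by
    rwa [NNReal.coe_mul, Real.coe_toNNReal _ hw.le]
  have hlaw := map_pi_gaussianReal_sum_mul w v
  have hint := integrable_exp_mul_sq_gaussianReal hv' hs'
  have heq := integral_exp_mul_sq_gaussianReal hv' hs'
  rw [← hlaw] at hint heq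
  have hm : Measurable fun r : Fin d → ℝ => ∑ i, w i * r i := by fun_prop
  rw [integral_map hm.aemeasurable (by fun_prop), NNReal.coe_mul,
    Real.coe_toNNReal _ hw.le] at heq
  rw [integrable_map_measure (by fun_prop) hm.aemeasurable] at hint
  simp only [mgf, hexp]
  generalize hG : (fun r : Fin d → ℝ => Real.exp (s * (∑ i, w i * r i) ^ 2)) = G at heq
  replace hint : Integrable G (Measure.pi fun _ : Fin d => gaussianReal 0 v) := hG ▸ hint
  have hG' : ∀ r : Fin d → ℝ, Real.exp (s * (∑ i, w i * r i) ^ 2) = G r := congrFun hG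
  simp only [hG']
  constructor
  · exact Integrable.fintype_prod (f := fun _ : Fin k => G) (fun _ => hint)
  · rw [integral_fintype_prod_eq_prod (fun _ : Fin k => G)]
    simp only [heq, Finset.prod_const, Finset.card_univ, Fintype.card_fin]

/-- The optimized Chernoff exponent of a chi-squared variable. -/
lemma exp_mul_mgf_projSq {d k : ℕ} (hk : 0 < k) (w : Fin d → ℝ) (hw : 0 < ∑ i, w i ^ 2) {a : ℝ}
    (ha : 0 < a) {s : ℝ} (hs : s = k * (1 - a⁻¹) / (2 * ∑ i, w i ^ 2)) :
    Integrable (fun Q => Real.exp (s * projSq w Q))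
        (Measure.pi fun _ : Fin k => Measure.pi fun _ : Fin d => gaussianReal 0 (1 / (k : ℝ≥0))) ∧
      Real.exp (-s * (a * ∑ i, w i ^ 2)) *
        mgf (projSq w) (Measure.pi fun _ : Fin k => Measure.pi fun _ : Fin d =>
          gaussianReal 0 (1 / (k : ℝ≥0))) s = Real.exp (-(k / 2 * (a - 1 - Real.log a))) := by
  have hk' : (0 : ℝ) < k := by exact_mod_cast hk
  have hv : (1 / (k : ℝ≥0)) ≠ 0 := by positivity
  have hval : 2 * s * ((∑ i, w i ^ 2) * ((1 / (k : ℝ≥0) : ℝ≥0) : ℝ)) = 1 - a⁻¹ := by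
    rw [hs]
    push_cast
    field_simp
  obtain ⟨h1, h2⟩ := mgf_projSq (k := k) hv w hw (s := s)
    (by rw [hval]; linarith [inv_pos.2 ha])
  refine ⟨h1, ?_⟩
  rw [h2, hval, sub_sub_cancel, Real.sqrt_inv, inv_inv]
  have hsq : √a = Real.exp (Real.log a / 2) := by
    rw [Real.sqrt_eq_rpow, Real.rpow_def_of_pos ha]
    ring_nf
  rw [hsq, ← Real.exp_nat_mul, ← Real.exp_add, hs]
  congr 1
  field_simp
  ring

lemma measureReal_le_projSq {d k : ℕ} (hk : 0 < k) (w : Fin d → ℝ) (hw : 0 < ∑ i, w i ^ 2) {a : ℝ}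
    (ha : 1 ≤ a) :
    (Measure.pi fun _ : Fin k => Measure.pi fun _ : Fin d =>
      gaussianReal 0 (1 / (k : ℝ≥0))).real {Q | a * ∑ i, w i ^ 2 ≤ projSq w Q} ≤
      Real.exp (-(k / 2 * (a - 1 - Real.log a))) := by
  obtain ⟨h1, h2⟩ := exp_mul_mgf_projSq hk w hw (by linarith : 0 < a) rfl
  rw [← h2]
  refine measure_ge_le_exp_mul_mgf _ ?_ h1
  have : a⁻¹ ≤ 1 := inv_le_one_of_one_le₀ ha
  have : 0 ≤ 1 - a⁻¹ := by linarith
  positivity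

lemma measureReal_projSq_le {d k : ℕ} (hk : 0 < k) (w : Fin d → ℝ) (hw : 0 < ∑ i, w i ^ 2) {a : ℝ}
    (ha : 0 < a) (ha' : a ≤ 1) :
    (Measure.pi fun _ : Fin k => Measure.pi fun _ : Fin d =>
      gaussianReal 0 (1 / (k : ℝ≥0))).real {Q | projSq w Q ≤ a * ∑ i, w i ^ 2} ≤
      Real.exp (-(k / 2 * (a - 1 - Real.log a))) := by
  obtain ⟨h1, h2⟩ := exp_mul_mgf_projSq hk w hw ha rfl
  rw [← h2]
  refine measure_le_le_exp_mul_mgf _ ?_ h1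
  have : 1 ≤ a⁻¹ := (one_le_inv₀ ha).2 ha'
  exact div_nonpos_of_nonpos_of_nonneg
    (mul_nonpos_of_nonneg_of_nonpos (Nat.cast_nonneg _) (by linarith)) (by positivity)

lemma log_one_add_le_cubic {x : ℝ} (h0 : 0 ≤ x) (h1 : x ≤ 1) :
    Real.log (1 + x) ≤ x - (x ^ 2 - x ^ 3) / 2 := by
  rw [Real.log_le_iff_le_exp (by linarith)]
  have hy : 0 ≤ x - (x ^ 2 - x ^ 3) / 2 := by
    nlinarith [pow_nonneg h0 3, mul_nonneg h0 (sub_nonneg.2 h1)]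
  refine le_trans ?_ (Real.quadratic_le_exp_of_nonneg hy)
  have hz : x - x ^ 2 / 2 ≤ x - (x ^ 2 - x ^ 3) / 2 := by nlinarith [pow_nonneg h0 3]
  have hz0 : 0 ≤ x - x ^ 2 / 2 := by nlinarith
  nlinarith [pow_le_pow_left₀ hz0 hz 2, pow_nonneg h0 4]

lemma log_one_sub_le_cubic {x : ℝ} (h0 : 0 ≤ x) (h1 : x < 1) :
    Real.log (1 - x) ≤ -x - (x ^ 2 - x ^ 3) / 2 := by
  have h := Real.hasSum_pow_div_log_of_abs_lt_one (abs_lt.2 ⟨by linarith, h1⟩ : |x| < 1)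
  have := sum_le_hasSum (Finset.range 2) (fun i _ => by positivity) h
  norm_num [Finset.sum_range_succ] at this
  nlinarith [pow_nonneg h0 3]

lemma measureReal_projSq_distortion_le {d k : ℕ} (hk : 0 < k) (w : Fin d → ℝ) {ε : ℝ} (h0 : 0 < ε)
    (h1 : ε < 1) :
    (Measure.pi fun _ : Fin d => Measure.pi fun _ : Fin k =>
      gaussianReal 0 (1 / (k : ℝ≥0))).real {P | ¬ ((1 - ε) * ∑ i, w i ^ 2 ≤
        projSq w (fun j i => P i j) ∧ projSq w (fun j i => P i j) ≤ (1 + ε) * ∑ i, w i ^ 2)} ≤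
      2 * Real.exp (-(k * (ε ^ 2 - ε ^ 3) / 4)) := by
  rcases (Finset.sum_nonneg fun i _ => sq_nonneg (w i) :
    0 ≤ ∑ i, w i ^ 2).eq_or_lt with hw | hw
  · have hw0 : ∀ i, w i = 0 := fun i => by
      simpa using (Finset.sum_eq_zero_iff_of_nonneg fun i _ => sq_nonneg (w i)).1 hw.symm i
        (Finset.mem_univ i)
    simp only [projSq, hw0]
    simp
    positivity
  have hpres := measurePreserving_pi_transpose (ι := Fin d) (κ := Fin k)
    (gaussianReal 0 (1 / (k : ℝ≥0)))
  have hm : Measurable (projSq w : (Fin k → Fin d → ℝ) → ℝ) := by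
    unfold projSq
    fun_prop
  have hup := measureReal_le_projSq hk w hw (by linarith : 1 ≤ 1 + ε)
  have hlo := measureReal_projSq_le hk w hw (by linarith : 0 < 1 - ε) (by linarith)
  rw [← hpres.measureReal_preimage
    (measurableSet_le measurable_const hm).nullMeasurableSet] at hup
  rw [← hpres.measureReal_preimage
    (measurableSet_le hm measurable_const).nullMeasurableSet] at hlo
  have hk' : (0 : ℝ) ≤ k := Nat.cast_nonneg _
  have e1 : Real.exp (-(k / 2 * (1 + ε - 1 - Real.log (1 + ε)))) ≤
      Real.exp (-(k * (ε ^ 2 - ε ^ 3) / 4)) := by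
    rw [Real.exp_le_exp]
    nlinarith [mul_le_mul_of_nonneg_left (log_one_add_le_cubic h0.le h1.le) hk']
  have e2 : Real.exp (-(k / 2 * (1 - ε - 1 - Real.log (1 - ε)))) ≤
      Real.exp (-(k * (ε ^ 2 - ε ^ 3) / 4)) := by
    rw [Real.exp_le_exp]
    nlinarith [mul_le_mul_of_nonneg_left (log_one_sub_le_cubic h0.le h1) hk']
  rw [two_mul]
  refine (measureReal_mono ?_ (by finiteness)).trans ((measureReal_union_le _ _).trans
    (add_le_add (hup.trans e1) (hlo.trans e2)))
  intro P hP
  simp only [Set.mem_ofPred_eq, not_and_or, not_le] at hP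
  rcases hP with h | h
  · exact Or.inr h.le
  · exact Or.inl h.le

lemma vecNorm_sq {m : ℕ} (v : Fin m → ℝ) : vecNorm v ^ 2 = ∑ i, v i ^ 2 :=
  Real.sq_sqrt (Finset.sum_nonneg fun _ _ => sq_nonneg _)

lemma vecNorm_vecMul_sub_sq {d k : ℕ} (a b : Fin d → ℝ) (P : Fin d → Fin k → ℝ) :
    vecNorm (Matrix.vecMul a (Matrix.of P) - Matrix.vecMul b (Matrix.of P)) ^ 2 =
      projSq (a - b) (fun j i => P i j) := by
  rw [← Matrix.sub_vecMul, vecNorm_sq]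
  rfl

theorem stmt_11 {N d k : ℕ} (hN : 16 < N) (hd : 0 < d) (hk : 0 < k)
    (u : Fin N → Fin d → ℝ) (ε : ℝ) (hε : ε ∈ Set.Ioo (0 : ℝ) (1 / 2))
    (hkbound : (k : ℝ) ≥ 9 * Real.log N / (ε ^ 2 - ε ^ 3))
    (μ : Measure (Fin d → Fin k → ℝ))
    (hμ : μ = Measure.pi fun _ =>
      Measure.pi fun _ => gaussianReal 0 (1 / (k : ℝ≥0))) :
    μ {P | ∀ i i' : Fin N,
        (1 - ε) * vecNorm (u i - u i') ^ 2 ≤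
          vecNorm (Matrix.vecMul (u i) (Matrix.of P) -
            Matrix.vecMul (u i') (Matrix.of P)) ^ 2 ∧
        vecNorm (Matrix.vecMul (u i) (Matrix.of P) -
            Matrix.vecMul (u i') (Matrix.of P)) ^ 2 ≤
          (1 + ε) * vecNorm (u i - u i') ^ 2}
      ≥ 1 / 2 := by
  obtain ⟨h0, h1⟩ := hε
  have : IsProbabilityMeasure μ := by rw [hμ]; infer_instance
  simp only [vecNorm_vecMul_sub_sq]
  simp only [vecNorm_sq]
  set good : (Fin d → ℝ) → Set (Fin d → Fin k → ℝ) := fun w =>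
    {P | (1 - ε) * ∑ i, w i ^ 2 ≤ projSq w (fun j i => P i j) ∧
      projSq w (fun j i => P i j) ≤ (1 + ε) * ∑ i, w i ^ 2} with hgood
  have hneg : ∀ w, good (-w) = good w := by
    intro w
    simp [hgood, projSq]
  have hzero : good 0 = Set.univ := by
    simp [hgood, projSq]
  set q := Real.exp (-(k * (ε ^ 2 - ε ^ 3) / 4)) with hq
  have hbad : ∀ w, μ.real (good w)ᶜ ≤ 2 * q := fun w => by
    rw [hμ]
    exact measureReal_projSq_distortion_le hk w h0 (by linarith)
  have hqN : (N : ℝ) ^ 2 * q ≤ 1 / 2 := by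
    have hN' : (16 : ℝ) ≤ N := by exact_mod_cast hN.le
    have hpos : 0 < ε ^ 2 - ε ^ 3 := by nlinarith [pow_pos h0 2]
    have hkb : 9 * Real.log N ≤ k * (ε ^ 2 - ε ^ 3) := (div_le_iff₀ hpos).1 hkbound
    have hlog : 4 * Real.log 2 ≤ Real.log N := by
      have := Real.log_le_log (by norm_num) hN'
      rwa [show (16 : ℝ) = 2 ^ 4 by norm_num, Real.log_pow] at this
    have hN2 : (N : ℝ) ^ 2 = Real.exp (2 * Real.log N) := by
      rw [two_mul, Real.exp_add, Real.exp_log (by linarith), sq]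
    have h2 : (1 / 2 : ℝ) = Real.exp (-Real.log 2) := by
      rw [Real.exp_neg, Real.exp_log (by norm_num), one_div]
    rw [hN2, hq, ← Real.exp_add, h2, Real.exp_le_exp]
    linarith
  set bad : Set (Fin d → Fin k → ℝ) :=
    ⋃ i ∈ (Finset.univ : Finset (Fin N)), ⋃ i' ∈ Finset.Iio i, (good (u i - u i'))ᶜ with hbadset
  have hbadle : μ.real bad ≤ 1 / 2 := by
    refine (measureReal_biUnion_finset_le _ _).trans (le_trans ?_ hqN)
    calc ∑ i : Fin N, μ.real (⋃ i' ∈ Finset.Iio i, (good (u i - u i'))ᶜ)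
        ≤ ∑ i : Fin N, ((i : ℕ) : ℝ) * (2 * q) := by
          refine Finset.sum_le_sum fun i _ => (measureReal_biUnion_finset_le _ _).trans ?_
          refine (Finset.sum_le_card_nsmul _ _ (2 * q) fun i' _ => hbad _).trans ?_
          simp
      _ = ((∑ i ∈ Finset.range N, i) * 2 : ℕ) * q := by
          rw [← Finset.sum_mul, Fin.sum_univ_eq_sum_range (fun i => (i : ℝ))]
          push_cast
          ring
      _ ≤ (N : ℝ) ^ 2 * q := by
          rw [Finset.sum_range_id_mul_two]
          have : N * (N - 1) ≤ N ^ 2 := by rw [sq]; gcongr; omega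
          have : ((N * (N - 1) : ℕ) : ℝ) ≤ (N : ℝ) ^ 2 := by exact_mod_cast this
          gcongr
  have hcover : badᶜ ⊆ {P | ∀ i i' : Fin N, P ∈ good (u i - u i')} := by
    intro P hP i i'
    simp only [hbadset, Set.mem_compl_iff, Set.mem_iUnion, not_exists, not_not, Finset.mem_Iio,
      Finset.mem_univ, true_imp_iff] at hP
    rcases lt_trichotomy i' i with h | h | h
    · exact hP i i' h
    · rw [h, sub_self, hzero]
      trivial
    · rw [← neg_sub, hneg]
      exact hP i' i h
  have hle : 1 ≤ μ.real bad + μ.real badᶜ := by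
    rw [← probReal_univ (μ := μ), ← Set.union_compl_self bad]
    exact measureReal_union_le _ _
  have hfin : (1 / 2 : ℝ) ≤ μ.real {P | ∀ i i' : Fin N, P ∈ good (u i - u i')} := by
    linarith [measureReal_mono (μ := μ) hcover]
  have := ENNReal.ofReal_le_ofReal hfin
  rw [ofReal_measureReal] at this
  refine le_trans (le_of_eq ?_) this
  rw [ENNReal.ofReal_div_of_pos (by norm_num)]
  simp
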